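/- Let k be a commutative ring, A a commutative k-algebra, J ⊆ A an ideal, and S = A/J with quotient map π: A → S; assume S is flat as a k-module (e.g. k is a field). Regard S as an (S⊗_kA)-module via (s⊗a)·t := s·t·π(a), and S⊗_kS as an (S⊗_kA)-module via the surjection id⊗π: S⊗_kA → S⊗_kS. Then there is an isomorphism of S-modules Tor₁^{S⊗_kA}(S, S⊗_kS) ≅ J/J². -/

import Mathlib

/-!
STATEMENT 7: For `J ⊆ A` an ideal, `S = A/J` flat over `k`, regarding `S` as an
`(S ⊗[k] A)`-module via `(s ⊗ a)·t = s·t·π(a)` and `S ⊗[k] S` as an `(S ⊗[k] A)`-module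
via `id ⊗ π`, there is an isomorphism `Tor₁^{S⊗[k]A}(S, S ⊗[k] S) ≅ J/J²`.
-/

open TensorProduct CategoryTheory

noncomputable section

variable (k A : Type) [CommRing k] [CommRing A] [Algebra k A] (J : Ideal A)

/-- The quotient map `π : A → S = A/J`. -/
abbrev qmap : A →ₐ[k] A ⧸ J := Ideal.Quotient.mkₐ k J

/-- The map `ψ : S ⊗[k] A → S`, `s ⊗ a ↦ s·π(a)`. -/
def psiMap : (A ⧸ J) ⊗[k] A →ₐ[k] A ⧸ J :=
  Algebra.TensorProduct.lift (AlgHom.id k (A ⧸ J)) (qmap k A J) fun _ _ => Commute.all _ _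

/-- `S` as an `(S ⊗[k] A)`-module via `(s ⊗ a) · t := s·t·π(a)`. -/
def Smodule : Module ((A ⧸ J) ⊗[k] A) (A ⧸ J) := Module.compHom _ (psiMap k A J).toRingHom

/-- `S ⊗[k] S` as an `(S ⊗[k] A)`-module via `id ⊗ π`. -/
def SSmodule : Module ((A ⧸ J) ⊗[k] A) ((A ⧸ J) ⊗[k] (A ⧸ J)) :=
  Module.compHom _
    (Algebra.TensorProduct.map (AlgHom.id k (A ⧸ J)) (qmap k A J)).toRingHom

/-- `J/J²` as an `(S ⊗[k] A)`-module via `ψ` and its natural `S`-module structure. -/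
def cotangentModule' : Module ((A ⧸ J) ⊗[k] A) J.Cotangent :=
  Module.compHom _ (psiMap k A J).toRingHom

attribute [local instance] Smodule SSmodule cotangentModule'

namespace CategoryTheory

variable {C : Type*} [Category* C] [Abelian C]

namespace ProjectiveResolution

/-- The augmentation of a projective resolution, as a morphism to the resolved object. -/
def augmentation {Z : C} (Q : ProjectiveResolution Z) : Q.complex.X 0 ⟶ Z := Q.π.f 0

lemma d_comp_augmentation {Z : C} (Q : ProjectiveResolution Z) :
    Q.complex.d 1 0 ≫ Q.augmentation = 0 :=
  Q.complex_d_comp_π_f_zero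

instance {Z : C} (Q : ProjectiveResolution Z) : Epi Q.augmentation :=
  inferInstanceAs (Epi (Q.π.f 0))

/-- The augmentation of a projective resolution is the cokernel of the first differential. -/
def isColimitAugmentation {Z : C} (Q : ProjectiveResolution Z) :
    Limits.IsColimit (Limits.CokernelCofork.ofπ Q.augmentation Q.d_comp_augmentation) :=
  Q.isColimitCokernelCofork

lemma d_comp_augmentation_comp {Z P : C} (Q : ProjectiveResolution Z) (f : Z ⟶ P) :
    Q.complex.d 1 0 ≫ Q.augmentation ≫ f = 0 := by
  rw [← Category.assoc, d_comp_augmentation, Limits.zero_comp]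

/-- Splicing a projective resolution of the kernel `S.X₁` with a short exact sequence
whose middle term is projective. -/
def splice {S : ShortComplex C} (hS : S.ShortExact) [Projective S.X₂]
    (Q : ProjectiveResolution S.X₁) : ProjectiveResolution S.X₃ where
  complex := Q.complex.augment (Q.augmentation ≫ S.f) (Q.d_comp_augmentation_comp S.f)
  projective n := by
    cases n
    · exact ‹Projective S.X₂›
    · exact Q.projective _
  π := (ChainComplex.toSingle₀Equiv _ _).symm ⟨S.g, by
    change (Q.augmentation ≫ S.f) ≫ S.g = 0
    rw [Category.assoc, S.zero, Limits.comp_zero]⟩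
  quasiIso := ⟨fun n => by
    have := hS.epi_g
    have := hS.mono_f
    match n with
    | 0 =>
      have hw : (Q.augmentation ≫ S.f) ≫ S.g = 0 := by
        rw [Category.assoc, S.zero, Limits.comp_zero]
      have hex : (ShortComplex.mk _ _ hw).Exact := by
        let α : ShortComplex.mk _ _ hw ⟶ S :=
          { τ₁ := Q.augmentation
            τ₂ := 𝟙 _
            τ₃ := 𝟙 _ }
        exact (ShortComplex.exact_iff_of_epi_of_isIso_of_mono α).2 hS.exact
      rw [ChainComplex.quasiIsoAt₀_iff, ShortComplex.quasiIso_iff_of_zeros' _ rfl rfl rfl]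
      refine (ShortComplex.exact_and_epi_g_iff_of_iso (S₂ := ShortComplex.mk _ _ hw) ?_).2
        ⟨hex, hS.epi_g⟩
      refine ShortComplex.isoMk (Iso.refl _) (Iso.refl _) (Iso.refl _) ?_ ?_
      · exact (Category.id_comp _).trans (Category.comp_id _).symm
      · refine (Category.id_comp _).trans (Eq.trans ?_ (Category.comp_id _).symm)
        exact (ChainComplex.toSingle₀Equiv_symm_apply_f_zero (C := Q.complex.augment _ _) S.g _).symm
    | 1 =>
      have hex : (ShortComplex.mk (Q.complex.d 1 0) (Q.augmentation ≫ S.f)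
          (Q.d_comp_augmentation_comp S.f)).Exact := by
        let α : ShortComplex.mk _ _ Q.d_comp_augmentation ⟶
            ShortComplex.mk (Q.complex.d 1 0) (Q.augmentation ≫ S.f)
              (Q.d_comp_augmentation_comp S.f) :=
          { τ₁ := 𝟙 _
            τ₂ := 𝟙 _
            τ₃ := S.f }
        exact (ShortComplex.exact_iff_of_epi_of_isIso_of_mono α).1
          (ShortComplex.exact_of_g_is_cokernel _ Q.isColimitAugmentation)
      rw [quasiIsoAt_iff_exactAt' _ _ (ChainComplex.exactAt_succ_single_obj _ _),
        HomologicalComplex.exactAt_iff' _ 2 1 0 (by simp) (by simp)]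
      exact hex
    | n + 2 =>
      rw [quasiIsoAt_iff_exactAt' _ _ (ChainComplex.exactAt_succ_single_obj _ _),
        HomologicalComplex.exactAt_iff' _ (n + 3) (n + 2) (n + 1) (by simp) (by simp)]
      exact Q.exact_succ n⟩

end ProjectiveResolution

/-- Dimension shifting: if `F` is right exact and kills the kernel inclusion of a
presentation of `S.X₃` by a projective, then `L₁F(S.X₃)` is the value of `F` on the kernel. -/
def Functor.leftDerivedOneObjIso {D : Type*} [Category* D] [Abelian D]
    [HasProjectiveResolutions C] (F : C ⥤ D) [F.Additive] [Limits.PreservesFiniteColimits F]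
    {S : ShortComplex C} (hS : S.ShortExact) [Projective S.X₂] (h : F.map S.f = 0) :
    (F.leftDerived 1).obj S.X₃ ≅ F.obj S.X₁ :=
  let Q := projectiveResolution S.X₁
  let K := (F.mapHomologicalComplex _).obj (Q.splice hS).complex
  have hg : (K.sc' 2 1 0).g = 0 := by
    change F.map (Q.augmentation ≫ S.f) = 0
    rw [F.map_comp, h, Limits.comp_zero]
  (Q.splice hS).isoLeftDerivedObj F 1 ≪≫ K.homologyIsoSc' 2 1 0 (by simp) (by simp) ≪≫
    (ShortComplex.LeftHomologyData.ofIsColimitCokernelCofork (K.sc' 2 1 0) hg _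
      (Limits.CokernelCofork.mapIsColimit _ Q.isColimitAugmentation F)).homologyIso

end CategoryTheory

@[simp]
lemma psiMap_tmul (s : A ⧸ J) (a : A) :
    psiMap k A J (s ⊗ₜ a) = s * Ideal.Quotient.mk J a := by
  simp [psiMap]

lemma smul_quotient_def (r : (A ⧸ J) ⊗[k] A) (s : A ⧸ J) : r • s = psiMap k A J r * s := rfl

lemma smul_cotangent_def (r : (A ⧸ J) ⊗[k] A) (x : J.Cotangent) :
    r • x = psiMap k A J r • x := rfl

/-- The surjection `id ⊗ π`, as a morphism of `(S ⊗[k] A)`-modules. -/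
def mapQuotient : (A ⧸ J) ⊗[k] A →ₗ[(A ⧸ J) ⊗[k] A] (A ⧸ J) ⊗[k] (A ⧸ J) where
  toFun := Algebra.TensorProduct.map (AlgHom.id k (A ⧸ J)) (qmap k A J)
  map_add' := map_add _
  map_smul' r x := map_mul _ r x

lemma mapQuotient_surjective : Function.Surjective (mapQuotient k A J) :=
  TensorProduct.map_surjective Function.surjective_id Ideal.Quotient.mk_surjective

/-- The kernel of `id ⊗ π`. -/
abbrev kerMapQuotient : Submodule ((A ⧸ J) ⊗[k] A) ((A ⧸ J) ⊗[k] A) :=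
  LinearMap.ker (mapQuotient k A J)

instance : AddCommGroup (kerMapQuotient k A J) := Submodule.addCommGroup _

instance : Module ((A ⧸ J) ⊗[k] A) (kerMapQuotient k A J) := Submodule.module _

lemma psiMap_eq_zero_of_mem {x : (A ⧸ J) ⊗[k] A} (hx : x ∈ kerMapQuotient k A J) :
    psiMap k A J x = 0 := by
  have h : psiMap k A J = (Algebra.TensorProduct.lmul' k).comp
      (Algebra.TensorProduct.map (AlgHom.id k (A ⧸ J)) (qmap k A J)) := by
    ext <;> simp [psiMap]
  have hx' : Algebra.TensorProduct.map (AlgHom.id k (A ⧸ J)) (qmap k A J) x = 0 := hx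
  rw [h, AlgHom.comp_apply, hx', map_zero]

/-- The map `S ⊗[k] J → ker (id ⊗ π)` induced by the inclusion of `J`. -/
def tensorToKer : (A ⧸ J) ⊗[k] J →ₗ[k] kerMapQuotient k A J :=
  (LinearMap.lTensor (A ⧸ J) (J.subtype.restrictScalars k)).codRestrict
    ((kerMapQuotient k A J).restrictScalars k) fun x => by
      have : (Algebra.TensorProduct.map (AlgHom.id k (A ⧸ J)) (qmap k A J)).toLinearMap ∘ₗ
          LinearMap.lTensor (A ⧸ J) (J.subtype.restrictScalars k) = 0 := by
        ext s j
        simp [Ideal.Quotient.eq_zero_iff_mem.2 j.2]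
      exact LinearMap.congr_fun this x

@[simp]
lemma coe_tensorToKer_tmul (s : A ⧸ J) (j : J) :
    (tensorToKer k A J (s ⊗ₜ j) : (A ⧸ J) ⊗[k] A) = s ⊗ₜ (j : A) := rfl

lemma tensorToKer_bijective [Module.Flat k (A ⧸ J)] : Function.Bijective (tensorToKer k A J) := by
  constructor
  · have h := Module.Flat.lTensor_preserves_injective_linearMap (M := A ⧸ J)
      (J.subtype.restrictScalars k) J.injective_subtype
    exact fun x y hxy => h (congr_arg Subtype.val hxy)
  · rintro ⟨x, hx⟩
    have h : Function.Exact (J.subtype.restrictScalars k) (qmap k A J).toLinearMap := by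
      intro a
      simp [Ideal.Quotient.eq_zero_iff_mem]
    obtain ⟨y, hy⟩ := (lTensor_exact (A ⧸ J) h Ideal.Quotient.mk_surjective x).1 hx
    exact ⟨y, Subtype.ext hy⟩

instance : IsScalarTower k (A ⧸ J) J.Cotangent where
  smul_assoc c s x := by
    obtain ⟨a, rfl⟩ := Ideal.Quotient.mk_surjective s
    have h : c • Ideal.Quotient.mk J a = Ideal.Quotient.mk J (c • a) := rfl
    rw [h]
    exact smul_assoc c a x

/-- `S ⊗[k] J → J/J²`, `s ⊗ j ↦ s • [j]`. -/
def tensorToCotangent : (A ⧸ J) ⊗[k] J →ₗ[k] J.Cotangent :=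
  TensorProduct.lift
    (LinearMap.mk₂ k (fun (s : A ⧸ J) (j : J) => s • J.toCotangent j)
      (fun s s' j => add_smul s s' _) (fun c s j => smul_assoc c s _)
      (fun s j j' => by rw [map_add, smul_add])
      (fun c s j => by
        rw [LinearMap.map_smul_of_tower, ← algebraMap_smul (A ⧸ J) c (J.toCotangent j), smul_comm,
          algebraMap_smul]))

@[simp]
lemma tensorToCotangent_tmul (s : A ⧸ J) (j : J) :
    tensorToCotangent k A J (s ⊗ₜ j) = s • J.toCotangent j := rfl

lemma tmul_smul_eq {M : Type*} [AddCommGroup M] [Module ((A ⧸ J) ⊗[k] A) M]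
    (r : (A ⧸ J) ⊗[k] A) (s : A ⧸ J) (x : M) :
    s ⊗ₜ[(A ⧸ J) ⊗[k] A] (r • x) = (psiMap k A J r * s) ⊗ₜ x :=
  (smul_tmul r s x).symm

section Flat

variable [Module.Flat k (A ⧸ J)]

/-- Since `S` is flat over `k`, the kernel of `id ⊗ π` is `S ⊗[k] J`. -/
def tensorEquivKer : (A ⧸ J) ⊗[k] J ≃ₗ[k] kerMapQuotient k A J :=
  LinearEquiv.ofBijective (tensorToKer k A J) (tensorToKer_bijective k A J)

lemma smul_tensorEquivKer_tmul (s t : A ⧸ J) (a : A) (j : J) :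
    (s ⊗ₜ[k] a) • tensorEquivKer k A J (t ⊗ₜ j) = tensorEquivKer k A J ((s * t) ⊗ₜ (a • j)) :=
  Subtype.ext (Algebra.TensorProduct.tmul_mul_tmul s t a (j : A))

/-- The map `ker (id ⊗ π) → J/J²`, `s ⊗ j ↦ s • [j]`. -/
def kerToCotangent : kerMapQuotient k A J →ₗ[(A ⧸ J) ⊗[k] A] J.Cotangent where
  toFun x := tensorToCotangent k A J ((tensorEquivKer k A J).symm x)
  map_add' x y := by rw [map_add, map_add]
  map_smul' r x := by
    obtain ⟨y, rfl⟩ := (tensorEquivKer k A J).surjective x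
    rw [RingHom.id_apply, LinearEquiv.symm_apply_apply]
    induction r with
    | zero =>
      have h : (0 : (A ⧸ J) ⊗[k] A) • tensorEquivKer k A J y = 0 :=
        Subtype.ext (zero_mul _)
      have h' : (0 : (A ⧸ J) ⊗[k] A) • tensorToCotangent k A J y = 0 := by
        rw [smul_cotangent_def, map_zero, zero_smul]
      refine Eq.trans ?_ h'.symm
      refine (congr_arg
        (fun x => tensorToCotangent k A J ((tensorEquivKer k A J).symm x)) h).trans ?_
      simp only [LinearEquiv.map_zero, LinearMap.map_zero]
    | add r r' h h' => rw [add_smul, LinearEquiv.map_add, LinearMap.map_add, h, h', add_smul]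
    | tmul s a =>
      induction y with
      | zero =>
        rw [LinearEquiv.map_zero, smul_zero, LinearEquiv.map_zero, LinearMap.map_zero, smul_zero]
      | add y y' h h' =>
        rw [LinearEquiv.map_add, smul_add, LinearEquiv.map_add, LinearMap.map_add, h, h',
          LinearMap.map_add, smul_add]
      | tmul t j =>
        rw [smul_tensorEquivKer_tmul, LinearEquiv.symm_apply_apply, tensorToCotangent_tmul,
          tensorToCotangent_tmul, smul_cotangent_def, psiMap_tmul, map_smul, smul_smul,
          mul_right_comm, mul_smul _ (Ideal.Quotient.mk J a)]
        rfl

@[simp]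
lemma kerToCotangent_tensorEquivKer_tmul (s : A ⧸ J) (j : J) :
    kerToCotangent k A J (tensorEquivKer k A J (s ⊗ₜ j)) = s • J.toCotangent j := by
  change tensorToCotangent k A J ((tensorEquivKer k A J).symm _) = _
  rw [LinearEquiv.symm_apply_apply, tensorToCotangent_tmul]

/-- The map `S ⊗ ker (id ⊗ π) → J/J²` over `S ⊗[k] A`. -/
def quotientTensorKerToCotangent :
    (A ⧸ J) ⊗[(A ⧸ J) ⊗[k] A] kerMapQuotient k A J →ₗ[(A ⧸ J) ⊗[k] A] J.Cotangent :=
  TensorProduct.lift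
    (LinearMap.mk₂ _ (fun (s : A ⧸ J) (x : kerMapQuotient k A J) => s • kerToCotangent k A J x)
      (fun s s' x => add_smul s s' _)
      (fun r s x => by rw [smul_quotient_def, mul_smul, smul_cotangent_def])
      (fun s x x' => by rw [map_add, smul_add])
      (fun r s x => by rw [map_smul, smul_cotangent_def, smul_cotangent_def, smul_comm]))

/-- The additive map `J → S ⊗ ker (id ⊗ π)`, `j ↦ 1 ⊗ (1 ⊗ j)`. -/
def idealToQuotientTensorKer : J →+ (A ⧸ J) ⊗[(A ⧸ J) ⊗[k] A] kerMapQuotient k A J where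
  toFun j := 1 ⊗ₜ tensorEquivKer k A J (1 ⊗ₜ j)
  map_zero' := by rw [tmul_zero, LinearEquiv.map_zero, tmul_zero]
  map_add' j j' := by rw [tmul_add, LinearEquiv.map_add, tmul_add]

lemma tmul_tensorEquivKer_tmul (a : A) (j : J) :
    (1 : A ⧸ J) ⊗ₜ[(A ⧸ J) ⊗[k] A] tensorEquivKer k A J (1 ⊗ₜ (a • j)) =
      Ideal.Quotient.mk J a ⊗ₜ tensorEquivKer k A J (1 ⊗ₜ j) := by
  have h := smul_tensorEquivKer_tmul k A J 1 1 a j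
  rw [mul_one] at h
  rw [← h, tmul_smul_eq, psiMap_tmul, one_mul, mul_one]

lemma tmul_tensorEquivKer (s t : A ⧸ J) (j : J) :
    s ⊗ₜ[(A ⧸ J) ⊗[k] A] tensorEquivKer k A J (t ⊗ₜ j) =
      (s * t) ⊗ₜ tensorEquivKer k A J (1 ⊗ₜ j) := by
  have h := smul_tensorEquivKer_tmul k A J t 1 1 j
  rw [mul_one, one_smul] at h
  rw [← h, tmul_smul_eq, psiMap_tmul, map_one, mul_one, mul_comm]

lemma idealToQuotientTensorKer_surjective :
    Function.Surjective (idealToQuotientTensorKer k A J) := by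
  intro z
  rw [← AddMonoidHom.mem_mrange]
  induction z with
  | zero => exact zero_mem _
  | add z z' h h' => exact add_mem h h'
  | tmul s x =>
    obtain ⟨y, rfl⟩ := (tensorEquivKer k A J).surjective x
    induction y with
    | zero => rw [LinearEquiv.map_zero, tmul_zero]; exact zero_mem _
    | add y y' h h' => rw [LinearEquiv.map_add, tmul_add]; exact add_mem h h'
    | tmul t j =>
      obtain ⟨a, ha⟩ := Ideal.Quotient.mk_surjective (s * t)
      refine ⟨a • j, ?_⟩
      rw [tmul_tensorEquivKer, ← ha]
      exact tmul_tensorEquivKer_tmul k A J a j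

lemma idealToQuotientTensorKer_eq_zero {j : J} (hj : J.toCotangent j = 0) :
    idealToQuotientTensorKer k A J j = 0 := by
  have hj' : j ∈ (J • ⊤ : Submodule A J) := (Submodule.Quotient.mk_eq_zero _).1 hj
  induction hj' using Submodule.smul_induction_on' with
  | smul a ha i _ =>
    refine (tmul_tensorEquivKer_tmul k A J a i).trans ?_
    rw [Ideal.Quotient.eq_zero_iff_mem.2 ha, zero_tmul]
  | add x hx y hy h h' =>
    rw [AddMonoidHom.map_add, h ((Submodule.Quotient.mk_eq_zero _).2 hx),
      h' ((Submodule.Quotient.mk_eq_zero _).2 hy), add_zero]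

lemma quotientTensorKerToCotangent_ideal (j : J) :
    quotientTensorKerToCotangent k A J (idealToQuotientTensorKer k A J j) = J.toCotangent j := by
  change (1 : A ⧸ J) • kerToCotangent k A J (tensorEquivKer k A J (1 ⊗ₜ j)) = _
  rw [kerToCotangent_tensorEquivKer_tmul, one_smul, one_smul]

lemma quotientTensorKerToCotangent_bijective :
    Function.Bijective (quotientTensorKerToCotangent k A J) := by
  constructor
  · rw [injective_iff_map_eq_zero]
    intro z hz
    obtain ⟨j, rfl⟩ := idealToQuotientTensorKer_surjective k A J z
    rw [quotientTensorKerToCotangent_ideal] at hz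
    exact idealToQuotientTensorKer_eq_zero k A J hz
  · intro x
    obtain ⟨j, rfl⟩ := J.toCotangent_surjective x
    exact ⟨_, quotientTensorKerToCotangent_ideal k A J j⟩

/-- `S ⊗ ker (id ⊗ π) ≃ J/J²` over `S ⊗[k] A`. -/
def quotientTensorKerEquivCotangent :
    (A ⧸ J) ⊗[(A ⧸ J) ⊗[k] A] kerMapQuotient k A J ≃ₗ[(A ⧸ J) ⊗[k] A] J.Cotangent :=
  LinearEquiv.ofBijective _ (quotientTensorKerToCotangent_bijective k A J)

end Flat

/-- The presentation `0 → ker (id ⊗ π) → S ⊗[k] A → S ⊗[k] S → 0`. -/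
def quotientPresentation : ShortComplex (ModuleCat ((A ⧸ J) ⊗[k] A)) :=
  ShortComplex.mk (X₁ := ModuleCat.of _ (kerMapQuotient k A J))
    (X₂ := ModuleCat.of _ ((A ⧸ J) ⊗[k] A)) (X₃ := ModuleCat.of _ ((A ⧸ J) ⊗[k] (A ⧸ J)))
    (ModuleCat.ofHom (kerMapQuotient k A J).subtype) (ModuleCat.ofHom (mapQuotient k A J))
    (ModuleCat.hom_ext (LinearMap.ext fun x => x.2))

lemma quotientPresentation_shortExact : (quotientPresentation k A J).ShortExact where
  exact := (ShortComplex.ShortExact.moduleCat_exact_iff_function_exact _).2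
    (LinearMap.exact_subtype_ker_map (mapQuotient k A J))
  mono_f := (ModuleCat.mono_iff_injective _).2 (kerMapQuotient k A J).injective_subtype
  epi_g := (ModuleCat.epi_iff_surjective _).2 (mapQuotient_surjective k A J)

instance : Projective (quotientPresentation k A J).X₂ :=
  inferInstanceAs (Projective (ModuleCat.of _ ((A ⧸ J) ⊗[k] A)))

lemma tmul_coe_ker (s : A ⧸ J) (x : kerMapQuotient k A J) :
    s ⊗ₜ[(A ⧸ J) ⊗[k] A] (x : (A ⧸ J) ⊗[k] A) = 0 := by
  have h := tmul_smul_eq k A J (x : (A ⧸ J) ⊗[k] A) s (1 : (A ⧸ J) ⊗[k] A)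
  rwa [psiMap_eq_zero_of_mem k A J x.2, zero_mul, zero_tmul, smul_eq_mul, mul_one] at h

lemma lTensor_kerMapQuotient_subtype :
    (kerMapQuotient k A J).subtype.lTensor (A ⧸ J) = 0 :=
  TensorProduct.ext' fun s x => tmul_coe_ker k A J s x

lemma tensoringLeft_map_quotientPresentation_f :
    ((MonoidalCategory.tensoringLeft (ModuleCat ((A ⧸ J) ⊗[k] A))).obj
      (ModuleCat.of _ (A ⧸ J))).map (quotientPresentation k A J).f = 0 :=
  ModuleCat.hom_ext (lTensor_kerMapQuotient_subtype k A J)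

theorem statement7 [Module.Flat k (A ⧸ J)] :
    Nonempty
      ((((Tor (ModuleCat ((A ⧸ J) ⊗[k] A)) 1).obj
            (ModuleCat.of ((A ⧸ J) ⊗[k] A) (A ⧸ J))).obj
          (ModuleCat.of ((A ⧸ J) ⊗[k] A) ((A ⧸ J) ⊗[k] (A ⧸ J)))) ≅
        ModuleCat.of ((A ⧸ J) ⊗[k] A) J.Cotangent) := by
  have : Limits.PreservesFiniteColimits
      ((MonoidalCategory.tensoringLeft (ModuleCat ((A ⧸ J) ⊗[k] A))).obj
        (ModuleCat.of _ (A ⧸ J))) :=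
    inferInstanceAs (Limits.PreservesFiniteColimits
      (MonoidalCategory.tensorLeft (ModuleCat.of ((A ⧸ J) ⊗[k] A) (A ⧸ J))))
  exact ⟨Functor.leftDerivedOneObjIso _ (quotientPresentation_shortExact k A J)
    (tensoringLeft_map_quotientPresentation_f k A J) ≪≫
      (quotientTensorKerEquivCotangent k A J).toModuleIso⟩

end
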